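/- There is a constant C > 0 such that for every online set cover instance and every prediction X̂ : Finset U, there exists a randomized online algorithm μ (a PMF on maps List U → Finset S whose support consists of deterministic online algorithms) such that for every duplicate-free request sequence σ, the expected cost E_{A∼μ}[c(A σ)] ≤ C · (1 + log(1 + η(σ))) · (1 + log(card S)) · opt(σ.toFinset), where log is the natural logarithm and card S is the number of sets in the instance. -/

import Mathlib

open Finset

/-- An online set cover instance. -/
structure SetCoverInstance (U S : Type) [DecidableEq U] [Fintype S] [DecidableEq S] where
  sets : S → Finset U
  cost : S → ℝ
  cost_nonneg : ∀ s, 0 ≤ cost s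
  covers_all : ∀ u : U, ∃ s : S, u ∈ sets s

variable {U S : Type} [DecidableEq U] [Fintype S] [DecidableEq S]

/-- Cost of a finite collection of sets. -/
def SetCoverInstance.setCost (I : SetCoverInstance U S) (T : Finset S) : ℝ :=
  ∑ s ∈ T, I.cost s

/-- `T` covers `A` if every element of `A` lies in some chosen set. -/
def SetCoverInstance.Covers (I : SetCoverInstance U S) (T : Finset S) (A : Finset U) : Prop :=
  ∀ a ∈ A, ∃ s ∈ T, a ∈ I.sets s

/-- Optimum cost of covering a finite set of elements. -/
noncomputable def SetCoverInstance.optCost (I : SetCoverInstance U S) (A : Finset U) : ℝ :=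
  sInf {r : ℝ | ∃ T : Finset S, I.Covers T A ∧ r = I.setCost T}

/-- A deterministic online algorithm: prefix-monotone and always covering. -/
def SetCoverInstance.IsOnlineAlg (I : SetCoverInstance U S) (ALG : List U → Finset S) : Prop :=
  (∀ (σ : List U) (x : U), ALG σ ⊆ ALG (σ ++ [x])) ∧
  ∀ σ : List U, I.Covers (ALG σ) σ.toFinset

/-- The prediction error η(σ) = min(|Xσ|, |Xσ \ X̂| + |X̂ \ Xσ|). -/
def predErr (Xhat : Finset U) (σ : List U) : ℕ :=
  min σ.toFinset.card ((σ.toFinset \ Xhat).card + (Xhat \ σ.toFinset).card)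


namespace OSC

variable (I : SetCoverInstance U S)

lemma setCost_nonneg (T : Finset S) : 0 ≤ I.setCost T :=
  Finset.sum_nonneg fun s _ => I.cost_nonneg s

lemma setCost_mono {T T' : Finset S} (h : T ⊆ T') : I.setCost T ≤ I.setCost T' :=
  Finset.sum_le_sum_of_subset_of_nonneg h fun s _ _ => I.cost_nonneg s

lemma setCost_union (T T' : Finset S) : I.setCost (T ∪ T') ≤ I.setCost T + I.setCost T' := by
  unfold SetCoverInstance.setCost
  have := Finset.sum_union_inter (s₁ := T) (s₂ := T') (f := I.cost)
  have h2 : 0 ≤ ∑ s ∈ T ∩ T', I.cost s := Finset.sum_nonneg fun s _ => I.cost_nonneg s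
  linarith

lemma opt_exists (A : Finset U) : ∃ T, I.Covers T A ∧ I.setCost T = I.optCost A := by
  have hfin : {r : ℝ | ∃ T : Finset S, I.Covers T A ∧ r = I.setCost T}.Finite :=
    (Set.finite_range (fun T : Finset S => I.setCost T)).subset (by
      rintro r ⟨T, _, rfl⟩; exact ⟨T, rfl⟩)
  have hne : {r : ℝ | ∃ T : Finset S, I.Covers T A ∧ r = I.setCost T}.Nonempty :=
    ⟨_, Finset.univ, fun a _ => by
      obtain ⟨s, hs⟩ := I.covers_all a; exact ⟨s, Finset.mem_univ _, hs⟩, rfl⟩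
  obtain ⟨T, hT, h⟩ := hne.csInf_mem hfin
  exact ⟨T, hT, h.symm⟩

lemma opt_le {A : Finset U} {T : Finset S} (h : I.Covers T A) : I.optCost A ≤ I.setCost T :=
  csInf_le ⟨0, by rintro r ⟨T, _, rfl⟩; exact setCost_nonneg I T⟩ ⟨T, h, rfl⟩

lemma opt_nonneg (A : Finset U) : 0 ≤ I.optCost A := by
  obtain ⟨T, _, h⟩ := opt_exists I A
  rw [← h]; exact setCost_nonneg I T

lemma opt_mono {A B : Finset U} (h : A ⊆ B) : I.optCost A ≤ I.optCost B := by
  obtain ⟨T, hT, h'⟩ := opt_exists I B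
  rw [← h']; exact opt_le I fun a ha => hT a (h ha)

lemma exists_b : ∃ b : ℝ, 0 < b ∧ ∀ T, 0 < I.setCost T → b ≤ I.setCost T := by
  obtain ⟨T, hT, hmin⟩ := Finset.exists_min_image
    (Finset.univ : Finset (Finset S)) (fun T => if 0 < I.setCost T then I.setCost T else
      I.setCost Finset.univ + 1) ⟨∅, Finset.mem_univ _⟩
  refine ⟨if 0 < I.setCost T then I.setCost T else I.setCost Finset.univ + 1,
    ?_, fun T' h => ?_⟩
  · have := setCost_nonneg I Finset.univ
    split_ifs <;> linarith
  · have := hmin T' (Finset.mem_univ _)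
    simpa [h] using this

lemma opt_b {b : ℝ} (hb : ∀ T, 0 < I.setCost T → b ≤ I.setCost T) {A : Finset U}
    (h : 0 < I.optCost A) : b ≤ I.optCost A := by
  obtain ⟨T, _, h'⟩ := opt_exists I A
  rw [← h'] at h ⊢; exact hb T h

/-- fractional value -/
noncomputable def fx (I : SetCoverInstance U S) (s : S) (v : ℝ) : ℝ :=
  (Real.exp (v / I.cost s) - 1) / (Fintype.card S + 1)

lemma fx_nonneg (s : S) {v : ℝ} (hv : 0 ≤ v) : 0 ≤ fx I s v := by
  unfold fx
  have : (1 : ℝ) ≤ Real.exp (v / I.cost s) := Real.one_le_exp (div_nonneg hv (I.cost_nonneg s))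
  apply div_nonneg <;> [linarith; positivity]

lemma fx_mono (s : S) {v w : ℝ} (h : v ≤ w) : fx I s v ≤ fx I s w := by
  unfold fx
  have := I.cost_nonneg s
  gcongr

lemma fx_cont (s : S) : Continuous (fx I s) := by
  unfold fx; fun_prop

lemma exists_t (z : S → ℝ) (e : U) : ∃ t : ℝ, 0 ≤ t ∧ ((∀ s, 0 ≤ z s) →
    (((∃ s, e ∈ I.sets s ∧ I.cost s = 0) ∨
      1 ≤ ∑ s with e ∈ I.sets s, fx I s (z s + t)) ∧
    (0 < t → (∀ s, e ∈ I.sets s → 0 < I.cost s) ∧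
      ∑ s with e ∈ I.sets s, fx I s (z s + t) ≤ 1))) := by
  by_cases h0 : ∃ s, e ∈ I.sets s ∧ I.cost s = 0
  · exact ⟨0, le_rfl, fun _ => ⟨Or.inl h0, fun h => absurd h (lt_irrefl _)⟩⟩
  by_cases hz : ∀ s, 0 ≤ z s
  swap
  · exact ⟨0, le_rfl, fun h => absurd h hz⟩
  have hpos : ∀ s, e ∈ I.sets s → 0 < I.cost s := fun s hs =>
    lt_of_le_of_ne (I.cost_nonneg s) fun h => h0 ⟨s, hs, h.symm⟩
  set f : ℝ → ℝ := fun t => ∑ s with e ∈ I.sets s, fx I s (z s + t) with hf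
  by_cases h1 : 1 ≤ f 0
  · exact ⟨0, le_rfl, fun _ => ⟨Or.inr h1, fun h => absurd h (lt_irrefl _)⟩⟩
  have hc : Continuous f := by
    apply continuous_finsetSum
    intro s _
    exact (fx_cont I s).comp (by fun_prop)
  obtain ⟨s, hs⟩ := I.covers_all e
  set Tm := I.cost s * Real.log (Fintype.card S + 2)
  have hT0 : 0 ≤ Tm := mul_nonneg (I.cost_nonneg s) (Real.log_nonneg (by
    have : (0:ℝ) ≤ Fintype.card S := by positivity
    linarith))
  have hT : 1 ≤ f Tm := by
    have h2 : fx I s (z s + Tm) ≤ f Tm := by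
      apply Finset.single_le_sum (f := fun s => fx I s (z s + Tm))
      · intro s' _; exact fx_nonneg I s' (add_nonneg (hz s') hT0)
      · simp [hs]
    have h3 : fx I s Tm ≤ fx I s (z s + Tm) := fx_mono I s (by linarith [hz s])
    have h4 : fx I s Tm = 1 := by
      unfold fx
      rw [mul_div_cancel_left₀ _ (hpos s hs).ne', Real.exp_log (by positivity)]
      have : (Fintype.card S + 1 : ℝ) ≠ 0 := by positivity
      field_simp; ring
    linarith
  obtain ⟨t, ht, hft⟩ := intermediate_value_Icc hT0 hc.continuousOn ⟨(not_le.mp h1).le, hT⟩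
  exact ⟨t, ht.1, fun _ => ⟨Or.inr hft.ge, fun _ => ⟨hpos, hft.le⟩⟩⟩

/-- dual increments -/
noncomputable def tt (I : SetCoverInstance U S) (z : S → ℝ) (e : U) : ℝ :=
  (exists_t I z e).choose

/-- dual loads, on reversed lists -/
noncomputable def zz (I : SetCoverInstance U S) : List U → S → ℝ
  | [] => fun _ => 0
  | e :: r => fun s => zz I r s + if e ∈ I.sets s then tt I (zz I r) e else 0

lemma tt_nonneg (z : S → ℝ) (e : U) : 0 ≤ tt I z e := (exists_t I z e).choose_spec.1

lemma zz_nonneg (r : List U) (s : S) : 0 ≤ zz I r s := by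
  induction r with
  | nil => simp [zz]
  | cons e r ih =>
    simp only [zz]
    have := tt_nonneg I (zz I r) e
    split_ifs <;> linarith

lemma zz_le_cons (e : U) (r : List U) (s : S) : zz I r s ≤ zz I (e :: r) s := by
  simp only [zz]
  have := tt_nonneg I (zz I r) e
  split_ifs <;> linarith

lemma sum_zz_eq (e : U) (r : List U) : ∑ s with e ∈ I.sets s, fx I s (zz I (e :: r) s) =
    ∑ s with e ∈ I.sets s, fx I s (zz I r s + tt I (zz I r) e) := by
  apply Finset.sum_congr rfl
  intro s hs
  simp only [Finset.mem_filter] at hs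
  simp [zz, hs.2]

lemma zz_cover (e : U) (r : List U) : (∃ s, e ∈ I.sets s ∧ I.cost s = 0) ∨
      1 ≤ ∑ s with e ∈ I.sets s, fx I s (zz I (e :: r) s) := by
  rw [sum_zz_eq]
  exact ((exists_t I (zz I r) e).choose_spec.2 (zz_nonneg I r)).1

lemma tt_pos (e : U) (r : List U) (h : 0 < tt I (zz I r) e) :
    (∀ s, e ∈ I.sets s → 0 < I.cost s) ∧
      ∑ s with e ∈ I.sets s, fx I s (zz I (e :: r) s) ≤ 1 := by
  rw [sum_zz_eq]
  exact ((exists_t I (zz I r) e).choose_spec.2 (zz_nonneg I r)).2 h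

lemma zz_le (r : List U) (s : S) : zz I r s ≤ I.cost s * Real.log (Fintype.card S + 2) := by
  induction r with
  | nil =>
    simp only [zz]
    refine mul_nonneg (I.cost_nonneg s) (Real.log_nonneg ?_)
    have : (0:ℝ) ≤ Fintype.card S := by positivity
    linarith
  | cons e r ih =>
    by_cases he : e ∈ I.sets s
    swap
    · simpa [zz, he] using ih
    rcases (tt_nonneg I (zz I r) e).eq_or_lt with h | h
    · simpa [zz, he, ← h] using ih
    obtain ⟨h1, h2⟩ := tt_pos I e r h
    have h3 : fx I s (zz I (e :: r) s) ≤ 1 := by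
      refine le_trans ?_ h2
      apply Finset.single_le_sum (f := fun s => fx I s (zz I (e :: r) s))
      · intro s' _; exact fx_nonneg I s' (zz_nonneg I _ _)
      · simp [he]
    unfold fx at h3
    rw [div_le_one (by positivity)] at h3
    have h4 : zz I (e :: r) s / I.cost s ≤ Real.log (Fintype.card S + 2) := by
      rw [Real.le_log_iff_exp_le (by positivity)]; linarith
    rw [div_le_iff₀ (h1 s he)] at h4
    linarith

lemma fx_step (s : S) (hc : 0 < I.cost s) (v t : ℝ) :
    I.cost s * (fx I s (v + t) - fx I s v) ≤
      t * (fx I s (v + t) + 1 / (Fintype.card S + 1)) := by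
  unfold fx
  have hm : (0 : ℝ) < Fintype.card S + 1 := by positivity
  set c := I.cost s
  set M : ℝ := Fintype.card S + 1
  have h1 : Real.exp (v / c) = Real.exp ((v + t) / c) * Real.exp (-(t / c)) := by
    rw [← Real.exp_add]; congr 1; ring
  have h2 : 1 - t / c ≤ Real.exp (-(t / c)) := by
    have := Real.add_one_le_exp (-(t / c)); linarith
  have h3 := Real.exp_pos ((v + t) / c)
  set E := Real.exp ((v + t) / c)
  rw [h1]
  have h4 : c * ((E - 1) / M - (E * Real.exp (-(t / c)) - 1) / M) =
    (c * E * (1 - Real.exp (-(t / c)))) / M := by ring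
  have h5 : t * ((E - 1) / M + 1 / M) = (c * E * (t / c)) / M := by field_simp; ring
  rw [h4, h5]
  gcongr
  linarith

lemma primal_le (r : List U) (T : Finset S) (hT : I.Covers T r.toFinset) :
    ∑ s, I.cost s * fx I s (zz I r s) ≤ 2 * ∑ s ∈ T, zz I r s := by
  induction r with
  | nil => simp [zz, fx]
  | cons e r ih =>
    have ih := ih fun a ha => hT a (by simp at ha ⊢; exact Or.inr ha)
    obtain ⟨s0, hs0, he0⟩ := hT e (by simp)
    set t := tt I (zz I r) e with ht
    have ht0 : 0 ≤ t := tt_nonneg I _ _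
    have hR : ∑ s ∈ T, zz I r s + t ≤ ∑ s ∈ T, zz I (e :: r) s := by
      simp only [zz, Finset.sum_add_distrib, ← ht]
      gcongr
      have := Finset.single_le_sum (f := fun s => if e ∈ I.sets s then t else 0) (s := T)
        (fun s _ => by split_ifs <;> simp [ht0]) hs0
      simpa [he0] using this
    have hL : ∑ s, I.cost s * fx I s (zz I (e :: r) s) ≤
        ∑ s, I.cost s * fx I s (zz I r s) + 2 * t := by
      rcases ht0.eq_or_lt with h | h
      · have : zz I (e :: r) = zz I r := by
          funext s; simp [zz, ← ht, ← h]
        rw [this]; linarith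
      obtain ⟨h1, h2⟩ := tt_pos I e r h
      have h3 : ∑ s, (I.cost s * fx I s (zz I (e :: r) s) - I.cost s * fx I s (zz I r s)) ≤
          ∑ s with e ∈ I.sets s, t * (fx I s (zz I (e :: r) s) + 1 / (Fintype.card S + 1)) := by
        rw [Finset.sum_filter]
        apply Finset.sum_le_sum
        intro s _
        split_ifs with hs
        · have := fx_step I s (h1 s hs) (zz I r s) t
          simp only [zz, hs, if_true, ← ht]
          linarith
        · simp [zz, hs]
      rw [Finset.sum_sub_distrib, ← Finset.mul_sum, Finset.sum_add_distrib] at h3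
      have h4 : ∑ s with e ∈ I.sets s, (1 / (Fintype.card S + 1) : ℝ) ≤ 1 := by
        rw [Finset.sum_const, nsmul_eq_mul, mul_one_div, div_le_one (by positivity)]
        have : ((Finset.univ.filter fun s => e ∈ I.sets s).card : ℝ) ≤ Fintype.card S := by
          exact_mod_cast Finset.card_le_univ _
        linarith
      have : t * (∑ s with e ∈ I.sets s, fx I s (zz I (e :: r) s) +
          ∑ s with e ∈ I.sets s, (1 / (Fintype.card S + 1) : ℝ)) ≤ t * 2 := by
        gcongr; linarith
      linarith
    linarith

lemma primal_opt (r : List U) : ∑ s, I.cost s * fx I s (zz I r s) ≤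
    2 * Real.log (Fintype.card S + 2) * I.optCost r.toFinset := by
  obtain ⟨T, hT, h⟩ := opt_exists I r.toFinset
  refine (primal_le I r T hT).trans ?_
  have : ∑ s ∈ T, zz I r s ≤ ∑ s ∈ T, I.cost s * Real.log (Fintype.card S + 2) :=
    Finset.sum_le_sum fun s _ => zz_le I r s
  rw [← Finset.sum_mul] at this
  rw [← h, SetCoverInstance.setCost]
  linarith


/-- rounding scale times fractional value -/
noncomputable def yy (I : SetCoverInstance U S) (r : List U) (s : S) : ℝ :=
  2 * Real.log (1 + r.length) * fx I s (zz I r s)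

lemma yy_nonneg (r : List U) (s : S) : 0 ≤ yy I r s := by
  unfold yy
  have := fx_nonneg I s (zz_nonneg I r s)
  have : 0 ≤ Real.log (1 + r.length) := Real.log_nonneg (by simp)
  positivity

lemma yy_mono (e : U) (r : List U) (s : S) : yy I r s ≤ yy I (e :: r) s := by
  unfold yy
  have h1 := fx_nonneg I s (zz_nonneg I r s)
  have h2 := fx_mono I s (zz_le_cons I e r s)
  have h3 : 0 ≤ Real.log (1 + r.length) := Real.log_nonneg (by simp)
  have h4 : Real.log (1 + r.length) ≤ Real.log (1 + (e :: r).length) := by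
    apply Real.log_le_log (by positivity)
    simp
  apply mul_le_mul _ h2 h1 (by linarith)
  linarith

open Classical in
/-- randomly rounded sets together with free sets -/
noncomputable def RR (I : SetCoverInstance U S) (N : ℕ) (θ : S → Fin N) (r : List U) : Finset S :=
  Finset.univ.filter fun s => I.cost s = 0 ∨ ((θ s : ℕ) : ℝ) < N * yy I r s

lemma exists_cheap (e : U) : ∃ s, e ∈ I.sets s ∧ ∀ s', e ∈ I.sets s' → I.cost s ≤ I.cost s' := by
  obtain ⟨s, hs, h⟩ := Finset.exists_min_image (Finset.univ.filter fun s => e ∈ I.sets s) I.cost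
    (by obtain ⟨s, hs⟩ := I.covers_all e; exact ⟨s, by simp [hs]⟩)
  exact ⟨s, by simpa using hs, fun s' hs' => h s' (by simp [hs'])⟩

/-- cheapest set containing an element -/
noncomputable def cheap (I : SetCoverInstance U S) (e : U) : S := (exists_cheap I e).choose

lemma cheap_mem (e : U) : e ∈ I.sets (cheap I e) := (exists_cheap I e).choose_spec.1

lemma cheap_le {e : U} {A : Finset U} (he : e ∈ A) : I.cost (cheap I e) ≤ I.optCost A := by
  obtain ⟨T, hT, h⟩ := opt_exists I A
  obtain ⟨s, hs, hes⟩ := hT e he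
  rw [← h]
  refine ((exists_cheap I e).choose_spec.2 s hes).trans ?_
  exact Finset.single_le_sum (f := I.cost) (fun s _ => I.cost_nonneg s) hs

open Classical in
/-- backup sets -/
noncomputable def Bk (I : SetCoverInstance U S) (N : ℕ) (θ : S → Fin N) : List U → Finset S
  | [] => ∅
  | e :: r => Bk I N θ r ∪ if ∃ s ∈ RR I N θ (e :: r), e ∈ I.sets s then ∅ else {cheap I e}

/-- the base algorithm, on reversed lists -/
noncomputable def FF (I : SetCoverInstance U S) (N : ℕ) (θ : S → Fin N) (r : List U) : Finset S :=
  RR I N θ r ∪ Bk I N θ r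

lemma RR_mono (N : ℕ) (θ : S → Fin N) (e : U) (r : List U) : RR I N θ r ⊆ RR I N θ (e :: r) := by
  intro s
  simp only [RR, Finset.mem_filter, Finset.mem_univ, true_and]
  rintro (h | h)
  · exact Or.inl h
  · refine Or.inr (h.trans_le ?_)
    have := yy_mono I e r s
    gcongr

lemma FF_mono (N : ℕ) (θ : S → Fin N) (e : U) (r : List U) : FF I N θ r ⊆ FF I N θ (e :: r) := by
  unfold FF
  apply Finset.union_subset_union (RR_mono I N θ e r)
  simp only [Bk]
  exact Finset.subset_union_left

lemma FF_covers (N : ℕ) (θ : S → Fin N) (r : List U) : I.Covers (FF I N θ r) r.toFinset := by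
  induction r with
  | nil => intro a ha; simp at ha
  | cons e r ih =>
    intro a ha
    simp only [List.toFinset_cons, Finset.mem_insert] at ha
    rcases ha with rfl | ha
    · by_cases h : ∃ s ∈ RR I N θ (a :: r), a ∈ I.sets s
      · obtain ⟨s, hs, hs'⟩ := h
        exact ⟨s, Finset.mem_union_left _ hs, hs'⟩
      · refine ⟨cheap I a, Finset.mem_union_right _ ?_, cheap_mem I a⟩
        simp [Bk, h]
    · obtain ⟨s, hs, hs'⟩ := ih a ha
      exact ⟨s, FF_mono I N θ e r hs, hs'⟩

lemma card_ge (N : ℕ) (y : ℝ) (hy : 0 ≤ y) :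
    (((Finset.univ : Finset (Fin N)).filter fun i : Fin N => ¬ ((i : ℕ) : ℝ) < N * y).card : ℝ)
      ≤ N * Real.exp (-y) := by
  have h1 : (((Finset.univ : Finset (Fin N)).filter fun i : Fin N => ¬ ((i : ℕ) : ℝ) < N * y).card)
      ≤ N - ⌈N * y⌉₊ := by
    rw [← Nat.card_Ico]
    rw [← Finset.card_map Fin.valEmbedding]
    apply Finset.card_le_card
    intro i hi
    simp only [Finset.mem_map, Finset.mem_filter, Finset.mem_univ, true_and, not_lt] at hi
    obtain ⟨j, hj, rfl⟩ := hi
    simp only [Finset.mem_Ico]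
    exact ⟨Nat.ceil_le.mpr hj, j.2⟩
  have h2 : ((N - ⌈N * y⌉₊ : ℕ) : ℝ) ≤ N * Real.exp (-y) := by
    rcases le_total N ⌈(N:ℝ) * y⌉₊ with h | h
    · rw [Nat.sub_eq_zero_of_le h]; simp; positivity
    · rw [Nat.cast_sub h]
      have := Nat.le_ceil ((N:ℝ) * y)
      have h3 := Real.add_one_le_exp (-y)
      have : (N:ℝ) * (-y + 1) ≤ N * Real.exp (-y) := by gcongr
      linarith
  exact le_trans (by exact_mod_cast h1) h2

lemma card_lt (N : ℕ) (y : ℝ) (hy : 0 ≤ y) :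
    (((Finset.univ : Finset (Fin N)).filter fun i : Fin N => ((i : ℕ) : ℝ) < N * y).card : ℝ)
      ≤ N * y + 1 := by
  have h1 : (((Finset.univ : Finset (Fin N)).filter fun i : Fin N => ((i : ℕ) : ℝ) < N * y).card)
      ≤ ⌈N * y⌉₊ := by
    rw [← Finset.card_range ⌈N * y⌉₊]
    rw [← Finset.card_map Fin.valEmbedding]
    apply Finset.card_le_card
    intro i hi
    simp only [Finset.mem_map, Finset.mem_filter, Finset.mem_univ, true_and] at hi
    obtain ⟨j, hj, rfl⟩ := hi
    simp only [Finset.mem_range]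
    exact Nat.lt_ceil.mpr hj
  have h2 := (Nat.ceil_lt_add_one (a := (N:ℝ) * y) (by positivity)).le
  exact le_trans (by exact_mod_cast h1) h2

/-- number of threshold vectors with a condition on each coordinate -/
lemma card_pi (N : ℕ) (P : S → Finset (Fin N)) :
    ((Finset.univ.filter fun θ : S → Fin N => ∀ s, θ s ∈ P s).card : ℝ) = ∏ s, ((P s).card : ℝ) := by
  have : (Finset.univ.filter fun θ : S → Fin N => ∀ s, θ s ∈ P s) = Fintype.piFinset P := by
    ext θ; simp
  rw [this, Fintype.card_piFinset]; push_cast; rfl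

lemma card_uncov (N : ℕ) (e : U) (r : List U)
    (h0 : ¬ ∃ s, e ∈ I.sets s ∧ I.cost s = 0) :
    ((Finset.univ.filter fun θ : S → Fin N => ∀ s, e ∈ I.sets s →
      ¬ ((θ s : ℕ) : ℝ) < N * yy I (e :: r) s).card : ℝ)
      ≤ (N : ℝ) ^ (Fintype.card S) * (1 / ((r.length : ℝ) + 2) ^ 2) := by
  have h1 := (zz_cover I e r).resolve_left h0
  have := card_pi N (fun s : S => if e ∈ I.sets s then
    (Finset.univ : Finset (Fin N)).filter fun i : Fin N => ¬ ((i : ℕ) : ℝ) < N * yy I (e :: r) s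
    else Finset.univ)
  have h2 : (Finset.univ.filter fun θ : S → Fin N => ∀ s, e ∈ I.sets s →
      ¬ ((θ s : ℕ) : ℝ) < N * yy I (e :: r) s) = (Finset.univ.filter fun θ : S → Fin N => ∀ s,
      θ s ∈ (if e ∈ I.sets s then
    (Finset.univ : Finset (Fin N)).filter fun i : Fin N => ¬ ((i : ℕ) : ℝ) < N * yy I (e :: r) s
    else Finset.univ)) := by
    apply Finset.filter_congr
    intro θ _
    apply forall_congr'
    intro s
    split_ifs with h <;> simp [h]
  rw [h2, this]
  have h3 : ∀ s, (((if e ∈ I.sets s then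
    (Finset.univ : Finset (Fin N)).filter fun i : Fin N => ¬ ((i : ℕ) : ℝ) < N * yy I (e :: r) s
    else Finset.univ) : Finset (Fin N)).card : ℝ) ≤
      N * Real.exp (-(if e ∈ I.sets s then yy I (e :: r) s else 0)) := by
    intro s
    split_ifs with h
    · exact card_ge N _ (yy_nonneg I _ s)
    · simp
  refine (Finset.prod_le_prod (fun s _ => by positivity) fun s _ => h3 s).trans ?_
  rw [Finset.prod_mul_distrib, Finset.prod_const, Finset.card_univ, ← Real.exp_sum,
    Finset.sum_neg_distrib, ← Finset.sum_filter]
  gcongr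
  have h4 : ∑ s with e ∈ I.sets s, yy I (e :: r) s =
    2 * Real.log (1 + (e :: r).length) * ∑ s with e ∈ I.sets s, fx I s (zz I (e :: r) s) := by
    rw [Finset.mul_sum]; rfl
  have h5 : 0 ≤ Real.log (1 + (e :: r).length) := Real.log_nonneg (by simp; positivity)
  have h6 : 2 * Real.log (1 + (e :: r).length) ≤ ∑ s with e ∈ I.sets s, yy I (e :: r) s := by
    rw [h4]; nlinarith
  have h7 : (1 / ((r.length : ℝ) + 2) ^ 2) = Real.exp (-(2 * Real.log (1 + (e :: r).length))) := by
    rw [Real.exp_neg, two_mul, Real.exp_add, Real.exp_log (by positivity)]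
    simp only [List.length_cons]; push_cast
    rw [one_div]; congr 1; ring
  rw [h7]
  gcongr

lemma E_Bk (N : ℕ) (r : List U) : ∑ θ : S → Fin N, I.setCost (Bk I N θ r) ≤
    (N : ℝ) ^ (Fintype.card S) * ((1 - 1 / ((r.length : ℝ) + 1)) * I.optCost r.toFinset) := by
  induction r with
  | nil => simp [Bk, SetCoverInstance.setCost]
  | cons e r ih =>
    classical
    set O := I.optCost (e :: r).toFinset with hO
    have hO0 : 0 ≤ O := opt_nonneg I _
    have h1 : I.optCost r.toFinset ≤ O := opt_mono I (by simp)
    have h2 : I.cost (cheap I e) ≤ O := cheap_le I (by simp)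
    have hr : (0:ℝ) ≤ r.length := by positivity
    have h4 : ∑ θ : S → Fin N, (if ∃ s ∈ RR I N θ (e :: r), e ∈ I.sets s then 0 else O) ≤
        (N : ℝ) ^ (Fintype.card S) * (1 / ((r.length : ℝ) + 2) ^ 2 * O) := by
      by_cases h0 : ∃ s, e ∈ I.sets s ∧ I.cost s = 0
      · obtain ⟨s, hs, hs'⟩ := h0
        rw [Finset.sum_eq_zero]
        · positivity
        · intro θ _
          rw [if_pos]
          exact ⟨s, by simp [RR, hs'], hs⟩
      · have := card_uncov I N e r h0
        rw [← mul_assoc]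
        refine le_trans ?_ (mul_le_mul_of_nonneg_right this hO0)
        rw [← nsmul_eq_mul, ← Finset.sum_const, Finset.sum_filter]
        apply Finset.sum_le_sum
        intro θ _
        split_ifs with h3 h5 h5
        · exact hO0
        · exact le_rfl
        · exact le_rfl
        · exfalso
          apply h5
          intro s hs hlt
          exact h3 ⟨s, by simp [RR, hlt], hs⟩
    have h5 : ∑ θ : S → Fin N, I.setCost (Bk I N θ (e :: r)) ≤
        ∑ θ : S → Fin N, I.setCost (Bk I N θ r) +
        ∑ θ : S → Fin N, (if ∃ s ∈ RR I N θ (e :: r), e ∈ I.sets s then 0 else O) := by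
      rw [← Finset.sum_add_distrib]
      apply Finset.sum_le_sum
      intro θ _
      simp only [Bk]
      refine (setCost_union I _ _).trans ?_
      gcongr
      split_ifs
      · simp [SetCoverInstance.setCost]
      · simpa [SetCoverInstance.setCost] using h2
    refine h5.trans ((add_le_add ih h4).trans ?_)
    rw [← mul_add]
    gcongr
    have h6 : 0 ≤ 1 - 1 / ((r.length : ℝ) + 1) := by
      rw [sub_nonneg, div_le_one (by positivity)]; linarith
    have h7 : (1 - 1 / ((r.length : ℝ) + 1)) * I.optCost r.toFinset ≤
      (1 - 1 / ((r.length : ℝ) + 1)) * O := by gcongr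
    have h8 : (1 - 1 / ((r.length : ℝ) + 1)) + 1 / ((r.length : ℝ) + 2) ^ 2 ≤
        1 - 1 / (((e :: r).length : ℝ) + 1) := by
      simp only [List.length_cons]; push_cast
      have : 1 / ((r.length : ℝ) + 1) - 1 / ((r.length : ℝ) + 1 + 1) -
          1 / ((r.length : ℝ) + 2) ^ 2 = 1 / (((r.length : ℝ) + 1) * ((r.length : ℝ) + 2) ^ 2) := by
        field_simp; ring
      have h9 : 0 ≤ 1 / (((r.length : ℝ) + 1) * ((r.length : ℝ) + 2) ^ 2) := by positivity
      linarith
    calc _ ≤ _ := add_le_add_left h7 _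
      _ = ((1 - 1 / ((r.length : ℝ) + 1)) + 1 / ((r.length : ℝ) + 2) ^ 2) * O := by ring
      _ ≤ _ := by gcongr

lemma E_RR (N : ℕ) (hN : 0 < N) {b : ℝ} (hb : ∀ T, 0 < I.setCost T → b ≤ I.setCost T)
    (hNb : I.setCost Finset.univ ≤ N * b) (r : List U) :
    ∑ θ : S → Fin N, I.setCost (RR I N θ r) ≤
    (N : ℝ) ^ (Fintype.card S) * (4 * Real.log (1 + r.length) * Real.log (Fintype.card S + 2) *
      I.optCost r.toFinset + I.optCost r.toFinset) := by
  classical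
  have hN' : (0:ℝ) < N := by exact_mod_cast hN
  have hl : 0 ≤ Real.log (1 + r.length) := Real.log_nonneg (by simp)
  have hp := primal_opt I r
  set O := I.optCost r.toFinset with hO
  have hcnt : ∀ s, ((Finset.univ.filter fun θ : S → Fin N =>
      ((θ s : ℕ) : ℝ) < N * yy I r s).card : ℝ) ≤
      (N : ℝ) ^ (Fintype.card S) * (yy I r s + 1 / N) := by
    intro s
    have := card_pi N (fun s' : S => if s' = s then
      (Finset.univ : Finset (Fin N)).filter fun i : Fin N => ((i : ℕ) : ℝ) < N * yy I r s
      else Finset.univ)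
    have h2 : (Finset.univ.filter fun θ : S → Fin N => ((θ s : ℕ) : ℝ) < N * yy I r s) =
      (Finset.univ.filter fun θ : S → Fin N => ∀ s', θ s' ∈ (if s' = s then
      (Finset.univ : Finset (Fin N)).filter fun i : Fin N => ((i : ℕ) : ℝ) < N * yy I r s
      else Finset.univ)) := by
      apply Finset.filter_congr
      intro θ _
      constructor
      · intro h s'
        split_ifs with h'
        · subst h'; simpa using h
        · simp
      · intro h
        simpa using h s
    rw [h2, this, ← Finset.mul_prod_erase _ _ (Finset.mem_univ s)]
    have h3 : ∏ x ∈ Finset.univ.erase s, (((if x = s then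
      (Finset.univ : Finset (Fin N)).filter fun i : Fin N => ((i : ℕ) : ℝ) < N * yy I r s
      else Finset.univ) : Finset (Fin N)).card : ℝ) = (N : ℝ) ^ (Fintype.card S - 1) := by
      rw [Finset.prod_congr rfl (g := fun _ => (N : ℝ))]
      · simp [Finset.card_erase_of_mem]
      · intro x hx
        simp [(Finset.mem_erase.mp hx).1]
    rw [h3]
    have h4 : (N : ℝ) ^ (Fintype.card S) = N * N ^ (Fintype.card S - 1) := by
      rw [← pow_succ']; congr 1
      have : 0 < Fintype.card S := Fintype.card_pos_iff.mpr ⟨s⟩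
      omega
    rw [h4]
    simp only [if_true]
    have h5 := card_lt N (yy I r s) (yy_nonneg I r s)
    calc _ ≤ (N * yy I r s + 1) * (N : ℝ) ^ (Fintype.card S - 1) := by gcongr
      _ = _ := by field_simp
  have hsum : ∑ θ : S → Fin N, I.setCost (RR I N θ r) =
      ∑ s, I.cost s * ((Finset.univ.filter fun θ : S → Fin N =>
      ((θ s : ℕ) : ℝ) < N * yy I r s).card : ℝ) := by
    have : ∀ θ : S → Fin N, I.setCost (RR I N θ r) =
        ∑ s, if ((θ s : ℕ) : ℝ) < N * yy I r s then I.cost s else 0 := by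
      intro θ
      rw [SetCoverInstance.setCost, RR, Finset.sum_filter]
      apply Finset.sum_congr rfl
      intro s _
      by_cases h : I.cost s = 0 <;> simp [h]
    simp_rw [this]
    rw [Finset.sum_comm]
    apply Finset.sum_congr rfl
    intro s _
    rw [← Finset.sum_filter, Finset.sum_const, nsmul_eq_mul, mul_comm]
  rw [hsum]
  rcases (opt_nonneg I r.toFinset).eq_or_lt with h0 | h0
  · rw [← hO] at h0
    rw [← h0] at hp ⊢
    simp only [mul_zero, add_zero] at hp ⊢
    have hz : ∀ s ∈ Finset.univ, I.cost s * fx I s (zz I r s) = 0 :=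
      (Finset.sum_eq_zero_iff_of_nonneg fun s _ =>
        mul_nonneg (I.cost_nonneg s) (fx_nonneg I s (zz_nonneg I r s))).mp
        (le_antisymm hp (Finset.sum_nonneg fun s _ =>
        mul_nonneg (I.cost_nonneg s) (fx_nonneg I s (zz_nonneg I r s))))
    apply le_of_eq
    apply Finset.sum_eq_zero
    intro s hs
    rcases mul_eq_zero.mp (hz s hs) with h | h
    · simp [h]
    · simp [yy, h]
  · have hbO := opt_b I hb h0
    calc _ ≤ ∑ s, I.cost s * ((N : ℝ) ^ (Fintype.card S) * (yy I r s + 1 / N)) := by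
          apply Finset.sum_le_sum
          intro s _
          exact mul_le_mul_of_nonneg_left (hcnt s) (I.cost_nonneg s)
      _ = (N : ℝ) ^ (Fintype.card S) * (2 * Real.log (1 + r.length) *
          (∑ s, I.cost s * fx I s (zz I r s)) + I.setCost Finset.univ / N) := by
          rw [SetCoverInstance.setCost, Finset.sum_div, Finset.mul_sum, ← Finset.sum_add_distrib,
            Finset.mul_sum]
          apply Finset.sum_congr rfl
          intro s _
          unfold yy; ring
      _ ≤ _ := by
          have h1 : I.setCost Finset.univ / N ≤ O := by
            rw [div_le_iff₀ hN']; nlinarith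
          have h2 := mul_le_mul_of_nonneg_left hp (show 0 ≤ 2 * Real.log (1 + r.length) by linarith)
          apply mul_le_mul_of_nonneg_left _ (by positivity)
          linarith

lemma log_bd (m : ℕ) : Real.log (m + 2) ≤ 2 * (1 + Real.log m) := by
  have h3 : Real.log 3 ≤ 2 := by
    have := Real.log_le_sub_one_of_pos (show (0:ℝ) < 3 by norm_num); linarith
  rcases Nat.eq_zero_or_pos m with rfl | h
  · have := Real.log_le_sub_one_of_pos (show (0:ℝ) < 2 by norm_num)
    simp; linarith
  · have h1 : (1:ℝ) ≤ m := by exact_mod_cast h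
    have h2 : Real.log (m + 2) ≤ Real.log (3 * m) :=
      Real.log_le_log (by positivity) (by linarith)
    rw [Real.log_mul (by norm_num) (by positivity)] at h2
    have := Real.log_nonneg h1
    linarith

lemma log_card_nonneg (m : ℕ) : 0 ≤ Real.log (m : ℝ) := Real.log_natCast_nonneg m

/-- the base algorithm -/
lemma base : ∃ N : ℕ, 0 < N ∧ ∀ r : List U,
    ∑ θ : S → Fin N, I.setCost (FF I N θ r) ≤ (N : ℝ) ^ (Fintype.card S) *
      (8 * ((1 + Real.log (1 + r.length)) * (1 + Real.log (Fintype.card S)) *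
        I.optCost r.toFinset)) := by
  obtain ⟨b, hb0, hb⟩ := exists_b I
  obtain ⟨N, hN⟩ := exists_nat_gt (I.setCost Finset.univ / b)
  have hNpos : 0 < N := by
    have : 0 ≤ I.setCost Finset.univ / b := div_nonneg (setCost_nonneg I _) hb0.le
    exact_mod_cast this.trans_lt hN
  refine ⟨N, hNpos, fun r => ?_⟩
  rw [div_lt_iff₀ hb0] at hN
  have h1 := E_RR I N hNpos hb hN.le r
  have h2 := E_Bk I N r
  have h3 : ∑ θ : S → Fin N, I.setCost (FF I N θ r) ≤
    ∑ θ : S → Fin N, I.setCost (RR I N θ r) + ∑ θ : S → Fin N, I.setCost (Bk I N θ r) := by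
    rw [← Finset.sum_add_distrib]
    exact Finset.sum_le_sum fun θ _ => setCost_union I _ _
  refine h3.trans ((add_le_add h1 h2).trans ?_)
  rw [← mul_add]
  gcongr
  set O := I.optCost r.toFinset
  have hO : 0 ≤ O := opt_nonneg I _
  have hl : 0 ≤ Real.log (1 + r.length) := Real.log_nonneg (by simp)
  have hm := log_card_nonneg (Fintype.card S)
  have hb := log_bd (Fintype.card S)
  have h4 : (1 - 1 / ((r.length : ℝ) + 1)) * O ≤ 1 * O := by
    gcongr
    have : 0 ≤ 1 / ((r.length : ℝ) + 1) := by positivity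
    linarith
  have h5 : 4 * Real.log (1 + r.length) * Real.log (Fintype.card S + 2) * O ≤
    4 * Real.log (1 + r.length) * (2 * (1 + Real.log (Fintype.card S))) * O := by gcongr
  have h6 : 0 ≤ Real.log (Fintype.card S) * O := by positivity
  nlinarith


/-- covered elements -/
def cov (I : SetCoverInstance U S) (T : Finset S) : Finset U := T.biUnion I.sets

lemma exists_P (X : Finset U) (B : ℝ) : ∃ T : Finset S, 0 ≤ B → (I.setCost T ≤ B ∧
    ∀ T', I.setCost T' ≤ B → (X \ cov I T).card ≤ (X \ cov I T').card) := by
  classical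
  by_cases hB : 0 ≤ B
  · obtain ⟨T, hT, h⟩ := Finset.exists_min_image
      ((Finset.univ : Finset (Finset S)).filter fun T => I.setCost T ≤ B)
      (fun T => (X \ cov I T).card) ⟨∅, Finset.mem_filter.mpr ⟨Finset.mem_univ _, by
        simpa [SetCoverInstance.setCost] using hB⟩⟩
    exact ⟨T, fun _ => ⟨by simpa using hT, fun T' hT' => h T' (by simpa using hT')⟩⟩
  · exact ⟨∅, fun h => absurd h hB⟩

/-- best partial cover of the prediction within a budget -/
noncomputable def PP (I : SetCoverInstance U S) (X : Finset U) (B : ℝ) : Finset S :=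
  (exists_P I X B).choose

/-- budget of a phase -/
noncomputable def bud (b : ℝ) (p : ℕ) : ℝ := b * (2 ^ p - 1)

lemma bud_nonneg {b : ℝ} (hb : 0 < b) (p : ℕ) : 0 ≤ bud b p := by
  unfold bud
  have : (1:ℝ) ≤ 2 ^ p := one_le_pow₀ (by norm_num)
  apply mul_nonneg hb.le; linarith

lemma bud_sum {b : ℝ} (hb : 0 < b) (p : ℕ) :
    ∑ q ∈ Finset.range p, bud b q ≤ bud b p := by
  induction p with
  | zero => simp [bud]
  | succ p ih =>
    rw [Finset.sum_range_succ]
    unfold bud at *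
    rw [pow_succ]; nlinarith

/-- requests not covered by the partial cover of phase `p` -/
noncomputable def flt (I : SetCoverInstance U S) (X : Finset U) (b : ℝ) (p : ℕ) (r : List U) :
    List U := r.filter fun u => decide (u ∉ cov I (PP I X (bud b p)))

/-- cost estimate of phase `p` -/
noncomputable def WW (I : SetCoverInstance U S) (X : Finset U) (b : ℝ) (p : ℕ) (r : List U) : ℝ :=
  (1 + Real.log (1 + (flt I X b p r).length)) * (1 + Real.log (Fintype.card S)) *
    I.optCost r.toFinset

lemma log_len_nonneg (n : ℕ) : 0 ≤ Real.log (1 + (n : ℝ)) := Real.log_nonneg (by simp)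

lemma WW_mono (X : Finset U) (b : ℝ) (p : ℕ) (e : U) (r : List U) :
    WW I X b p r ≤ WW I X b p (e :: r) := by
  unfold WW
  have hm := log_card_nonneg (Fintype.card S)
  have h1 := log_len_nonneg (flt I X b p r).length
  have h2 : I.optCost r.toFinset ≤ I.optCost (e :: r).toFinset := opt_mono I (by simp)
  have h3 := opt_nonneg I r.toFinset
  have h4 : ((flt I X b p r).length : ℝ) ≤ (flt I X b p (e :: r)).length := by
    exact_mod_cast ((List.sublist_cons_self e r).filter _).length_le
  have h5 := log_len_nonneg (flt I X b p (e :: r)).length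
  gcongr

lemma exists_ph (X : Finset U) {b : ℝ} (hb : 0 < b) (r : List U) :
    ∃ p, WW I X b p r ≤ bud b p := by
  obtain ⟨n, hn⟩ := exists_nat_gt (((1 + Real.log (1 + r.length)) * (1 + Real.log (Fintype.card S)) *
    I.optCost r.toFinset) / b)
  rw [div_lt_iff₀ hb] at hn
  refine ⟨n, le_trans ?_ (hn.le.trans ?_)⟩
  · unfold WW
    have hm := log_card_nonneg (Fintype.card S)
    have h3 := opt_nonneg I r.toFinset
    have h4 : ((flt I X b n r).length : ℝ) ≤ r.length := by
      exact_mod_cast List.length_filter_le _ _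
    gcongr
  · unfold bud
    have : n + 1 ≤ 2 ^ n := Nat.lt_two_pow_self
    have : ((n : ℝ) + 1) ≤ 2 ^ n := by exact_mod_cast this
    nlinarith

open Classical in
/-- current phase -/
noncomputable def ph (I : SetCoverInstance U S) (X : Finset U) {b : ℝ} (hb : 0 < b) (r : List U) :
    ℕ := Nat.find (exists_ph I X hb r)

lemma ph_spec (X : Finset U) {b : ℝ} (hb : 0 < b) (r : List U) :
    WW I X b (ph I X hb r) r ≤ bud b (ph I X hb r) := by
  classical
  exact Nat.find_spec (exists_ph I X hb r)

lemma ph_min (X : Finset U) {b : ℝ} (hb : 0 < b) (r : List U) {q : ℕ} (h : q < ph I X hb r) :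
    bud b q < WW I X b q r := by
  classical
  exact not_le.mp (Nat.find_min (exists_ph I X hb r) h)

lemma ph_mono (X : Finset U) {b : ℝ} (hb : 0 < b) (e : U) (r : List U) :
    ph I X hb r ≤ ph I X hb (e :: r) := by
  by_contra h
  have h1 := ph_min I X hb r (not_le.mp h)
  have h2 := ph_spec I X hb (e :: r)
  have h3 := WW_mono I X b (ph I X hb (e :: r)) e r
  linarith

/-- the main algorithm, on reversed lists -/
noncomputable def GG (I : SetCoverInstance U S) (X : Finset U) {b : ℝ} (hb : 0 < b) (N : ℕ)
    (θ : S → Fin N) : List U → Finset S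
  | [] => ∅
  | e :: r => GG I X hb N θ r ∪ (PP I X (bud b (ph I X hb (e :: r))) ∪
      FF I N θ (flt I X b (ph I X hb (e :: r)) (e :: r)))

lemma GG_covers (X : Finset U) {b : ℝ} (hb : 0 < b) (N : ℕ) (θ : S → Fin N) (r : List U) :
    I.Covers (GG I X hb N θ r) r.toFinset := by
  induction r with
  | nil => intro a ha; simp at ha
  | cons e r ih =>
    intro a ha
    simp only [List.toFinset_cons, Finset.mem_insert] at ha
    simp only [GG]
    set p := ph I X hb (e :: r)
    rcases ha with rfl | ha
    · by_cases h : a ∈ cov I (PP I X (bud b p))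
      · simp only [cov, Finset.mem_biUnion] at h
        obtain ⟨s, hs, hs'⟩ := h
        exact ⟨s, by simp [hs], hs'⟩
      · obtain ⟨s, hs, hs'⟩ := FF_covers I N θ (flt I X b p (a :: r)) a (by simp [flt, h])
        exact ⟨s, by simp [hs], hs'⟩
    · obtain ⟨s, hs, hs'⟩ := ih a ha
      exact ⟨s, by simp [hs], hs'⟩

lemma flt_FF (X : Finset U) (b : ℝ) (p : ℕ) (N : ℕ) (θ : S → Fin N) (e : U) (r : List U) :
    FF I N θ (flt I X b p r) ⊆ FF I N θ (flt I X b p (e :: r)) := by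
  by_cases h : e ∈ cov I (PP I X (bud b p))
  · simp [flt, h]
  · have : flt I X b p (e :: r) = e :: flt I X b p r := by simp [flt, h]
    rw [this]; exact FF_mono I N θ _ _

lemma E_phase (X : Finset U) {b : ℝ} (hb : 0 < b) {N : ℕ}
    (hN : ∀ r : List U,
    ∑ θ : S → Fin N, I.setCost (FF I N θ r) ≤ (N : ℝ) ^ (Fintype.card S) *
      (8 * ((1 + Real.log (1 + r.length)) * (1 + Real.log (Fintype.card S)) *
        I.optCost r.toFinset))) (r : List U) :
    ∑ θ : S → Fin N, I.setCost (PP I X (bud b (ph I X hb r)) ∪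
      FF I N θ (flt I X b (ph I X hb r) r)) ≤
      (N : ℝ) ^ (Fintype.card S) * (9 * bud b (ph I X hb r)) := by
  have hs := ph_spec I X hb r
  set p := ph I X hb r
  have h1 : I.setCost (PP I X (bud b p)) ≤ bud b p :=
    ((exists_P I X (bud b p)).choose_spec (bud_nonneg hb p)).1
  have h2 := hN (flt I X b p r)
  have h3 : (8 * ((1 + Real.log (1 + (flt I X b p r).length)) * (1 + Real.log (Fintype.card S)) *
        I.optCost (flt I X b p r).toFinset)) ≤ 8 * bud b p := by
    refine le_trans ?_ (mul_le_mul_of_nonneg_left hs (by norm_num))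
    unfold WW
    have : I.optCost (flt I X b p r).toFinset ≤ I.optCost r.toFinset := opt_mono I (by
      intro u; simp only [flt, List.mem_toFinset, List.mem_filter]; exact fun h => h.1)
    have hm := log_card_nonneg (Fintype.card S)
    have h5 := log_len_nonneg (flt I X b p r).length
    gcongr
  calc _ ≤ ∑ θ : S → Fin N, (bud b p + I.setCost (FF I N θ (flt I X b p r))) :=
        Finset.sum_le_sum fun θ _ => (setCost_union I _ _).trans (by gcongr)
    _ = (N : ℝ) ^ (Fintype.card S) * bud b p +
        ∑ θ : S → Fin N, I.setCost (FF I N θ (flt I X b p r)) := by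
        rw [Finset.sum_add_distrib]; simp
    _ ≤ (N : ℝ) ^ (Fintype.card S) * bud b p + (N : ℝ) ^ (Fintype.card S) * (8 * bud b p) := by
        gcongr
        exact h2.trans (by gcongr)
    _ = _ := by ring

lemma GG_decomp (X : Finset U) {b : ℝ} (hb : 0 < b) {N : ℕ}
    (hN : ∀ r : List U,
    ∑ θ : S → Fin N, I.setCost (FF I N θ r) ≤ (N : ℝ) ^ (Fintype.card S) *
      (8 * ((1 + Real.log (1 + r.length)) * (1 + Real.log (Fintype.card S)) *
        I.optCost r.toFinset))) (r : List U) :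
    ∃ D : (S → Fin N) → Finset S, (∀ θ, GG I X hb N θ r ⊆ D θ ∪ (PP I X (bud b (ph I X hb r)) ∪
      FF I N θ (flt I X b (ph I X hb r) r))) ∧
      ∑ θ, I.setCost (D θ) ≤ (N : ℝ) ^ (Fintype.card S) *
        (9 * ∑ q ∈ Finset.range (ph I X hb r), bud b q) := by
  induction r with
  | nil =>
    refine ⟨fun _ => ∅, fun θ => by simp [GG], ?_⟩
    have : 0 ≤ ∑ q ∈ Finset.range (ph I X hb []), bud b q :=
      Finset.sum_nonneg fun q _ => bud_nonneg hb q
    simp only [SetCoverInstance.setCost, Finset.sum_empty, Finset.sum_const_zero]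
    positivity
  | cons e r ih =>
    obtain ⟨D, hD, hDc⟩ := ih
    rcases (ph_mono I X hb e r).eq_or_lt with h | h
    · refine ⟨D, fun θ => ?_, by rw [← h]; exact hDc⟩
      simp only [GG]
      rw [← h]
      apply Finset.union_subset ((hD θ).trans _) Finset.subset_union_right
      exact Finset.union_subset_union_right (Finset.union_subset_union_right (flt_FF I X b _ N θ e r))
    · refine ⟨fun θ => D θ ∪ (PP I X (bud b (ph I X hb r)) ∪
        FF I N θ (flt I X b (ph I X hb r) r)), fun θ => ?_, ?_⟩
      · simp only [GG]
        exact Finset.union_subset_union_left (hD θ)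
      · have h1 := E_phase I X hb hN r
        have h2 : ∑ q ∈ Finset.range (ph I X hb r), bud b q + bud b (ph I X hb r) ≤
            ∑ q ∈ Finset.range (ph I X hb (e :: r)), bud b q := by
          rw [← Finset.sum_range_succ]
          apply Finset.sum_le_sum_of_subset_of_nonneg
          · intro q hq; simp at hq ⊢; omega
          · intro q _ _; exact bud_nonneg hb q
        calc _ ≤ ∑ θ : S → Fin N, (I.setCost (D θ) + I.setCost (PP I X (bud b (ph I X hb r)) ∪
              FF I N θ (flt I X b (ph I X hb r) r))) :=
              Finset.sum_le_sum fun θ _ => setCost_union I _ _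
          _ ≤ (N : ℝ) ^ (Fintype.card S) *
              (9 * (∑ q ∈ Finset.range (ph I X hb r), bud b q + bud b (ph I X hb r))) := by
              rw [Finset.sum_add_distrib]; linarith
          _ ≤ _ := by gcongr

lemma GG_cost (X : Finset U) {b : ℝ} (hb : 0 < b) {N : ℕ}
    (hN : ∀ r : List U,
    ∑ θ : S → Fin N, I.setCost (FF I N θ r) ≤ (N : ℝ) ^ (Fintype.card S) *
      (8 * ((1 + Real.log (1 + r.length)) * (1 + Real.log (Fintype.card S)) *
        I.optCost r.toFinset))) (r : List U) :
    ∑ θ, I.setCost (GG I X hb N θ r) ≤ (N : ℝ) ^ (Fintype.card S) * (18 * bud b (ph I X hb r)) := by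
  obtain ⟨D, hD, hDc⟩ := GG_decomp I X hb hN r
  have h1 := E_phase I X hb hN r
  have h2 := bud_sum hb (ph I X hb r)
  calc _ ≤ ∑ θ : S → Fin N, (I.setCost (D θ) + I.setCost (PP I X (bud b (ph I X hb r)) ∪
              FF I N θ (flt I X b (ph I X hb r) r))) :=
              Finset.sum_le_sum fun θ _ => (setCost_mono I (hD θ)).trans (setCost_union I _ _)
    _ ≤ (N : ℝ) ^ (Fintype.card S) *
        (9 * (∑ q ∈ Finset.range (ph I X hb r), bud b q + bud b (ph I X hb r))) := by
        rw [Finset.sum_add_distrib]; linarith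
    _ ≤ (N : ℝ) ^ (Fintype.card S) * (18 * bud b (ph I X hb r)) := by
        apply mul_le_mul_of_nonneg_left _ (by positivity)
        linarith

lemma bud_ph (X : Finset U) {b : ℝ} (hb : 0 < b) (hb' : ∀ T, 0 < I.setCost T → b ≤ I.setCost T)
    (r : List U) (hr : r.Nodup) :
    bud b (ph I X hb r) ≤ 6 * (1 + Real.log (1 + (predErr X r : ℝ))) *
      (1 + Real.log (Fintype.card S)) * I.optCost r.toFinset := by
  set O := I.optCost r.toFinset with hO
  set η := predErr X r with hη
  have hO0 : 0 ≤ O := opt_nonneg I _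
  have hm := log_card_nonneg (Fintype.card S)
  have hl := log_len_nonneg η
  have hKO : O ≤ (1 + Real.log (1 + (η : ℝ))) * (1 + Real.log (Fintype.card S)) * O := by
    have h1 : 1 ≤ (1 + Real.log (1 + (η : ℝ))) * (1 + Real.log (Fintype.card S)) := by nlinarith
    nlinarith
  rcases Nat.eq_zero_or_pos (ph I X hb r) with h0 | h0
  · rw [h0]
    simp only [bud, pow_zero, sub_self, mul_zero]
    positivity
  obtain ⟨q, hq⟩ := Nat.exists_eq_succ_of_ne_zero h0.ne'
  have hW := ph_min I X hb r (q := q) (by omega)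
  have hB : bud b (ph I X hb r) = 2 * bud b q + b := by
    rw [hq]; unfold bud; rw [pow_succ]; ring
  have hq0 := bud_nonneg hb q
  have hOpos : 0 < O := by
    rcases hO0.eq_or_lt with h | h
    · unfold WW at hW
      rw [← hO, ← h, mul_zero] at hW; linarith
    · exact h
  have hbO : b ≤ O := opt_b I hb' hOpos
  rw [hB]
  set j := (flt I X b q r).length with hj
  by_cases hjη : j ≤ 2 * η
  · have h1 : Real.log (1 + (j : ℝ)) ≤ 1 + Real.log (1 + (η : ℝ)) := by
      have h2 : Real.log (1 + (j : ℝ)) ≤ Real.log (2 * (1 + (η : ℝ))) := by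
        apply Real.log_le_log (by positivity)
        have : (j : ℝ) ≤ 2 * η := by exact_mod_cast hjη
        linarith
      rw [Real.log_mul (by norm_num) (by positivity)] at h2
      have := Real.log_le_sub_one_of_pos (show (0:ℝ) < 2 by norm_num)
      linarith
    have h3 : WW I X b q r ≤
        (2 * (1 + Real.log (1 + (η : ℝ)))) * (1 + Real.log (Fintype.card S)) * O := by
      unfold WW
      rw [← hj, ← hO]
      gcongr
      linarith
    linarith
  · have hjc : j = (r.toFinset \ cov I (PP I X (bud b q))).card := by
      rw [hj, flt, ← List.toFinset_card_of_nodup (hr.filter _), List.toFinset_filter]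
      congr 1
      ext u; simp
    have hjn : j ≤ r.toFinset.card := by
      rw [hjc]; exact Finset.card_le_card Finset.sdiff_subset
    have hηd : η = (r.toFinset \ X).card + (X \ r.toFinset).card := by
      rw [hη]; unfold predErr at *; omega
    have hsub : j ≤ (r.toFinset \ X).card + (X \ cov I (PP I X (bud b q))).card := by
      rw [hjc]
      refine (Finset.card_le_card ?_).trans (Finset.card_union_le _ _)
      intro u; simp only [Finset.mem_sdiff, Finset.mem_union]; tauto
    have hlt : bud b q < O := by
      by_contra hcon
      obtain ⟨T, hT, hTc⟩ := opt_exists I r.toFinset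
      have h1 := ((exists_P I X (bud b q)).choose_spec hq0).2 T (by rw [hTc]; exact not_lt.mp hcon)
      have h2 : (X \ cov I T).card ≤ (X \ r.toFinset).card := by
        apply Finset.card_le_card
        apply Finset.sdiff_subset_sdiff le_rfl
        intro u hu
        obtain ⟨s, hs, hs'⟩ := hT u hu
        exact Finset.mem_biUnion.mpr ⟨s, hs, hs'⟩
      change (X \ cov I (PP I X (bud b q))).card ≤ _ at h1
      omega
    linarith

lemma tsum_map {α Ω : Type} [Fintype Ω] [Nonempty Ω] (g : Ω → α) (f : α → ℝ) :
    (∑' a, (((PMF.uniformOfFintype Ω).map g) a).toReal * f a) =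
      (∑ ω, f (g ω)) / Fintype.card Ω := by
  classical
  have h1 : ∀ a, (((PMF.uniformOfFintype Ω).map g) a).toReal * f a =
      ∑ ω, if a = g ω then f (g ω) / Fintype.card Ω else 0 := by
    intro a
    rw [PMF.map_apply, tsum_fintype, ENNReal.toReal_sum, Finset.sum_mul]
    · apply Finset.sum_congr rfl
      intro ω _
      split_ifs with h
      · subst h
        simp [PMF.uniformOfFintype_apply, ENNReal.toReal_inv]
        ring
      · simp
    · intro ω _
      split_ifs
      · simp [PMF.uniformOfFintype_apply]
      · simp
  simp_rw [h1]
  rw [Summable.tsum_finsetSum, Finset.sum_div]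
  · apply Finset.sum_congr rfl
    intro ω _
    exact tsum_ite_eq (g ω) _
  · intro ω _
    exact (hasSum_ite_eq (g ω) _).summable

end OSC

theorem stmt7 :
    ∃ C : ℝ, 0 < C ∧
      ∀ (U S : Type) [DecidableEq U] [Fintype S] [DecidableEq S]
        (I : SetCoverInstance U S) (Xhat : Finset U),
        ∃ μ : PMF (List U → Finset S),
          (∀ A ∈ μ.support, I.IsOnlineAlg A) ∧
          ∀ σ : List U, σ.Nodup →
            (∑' A : List U → Finset S, (μ A).toReal * I.setCost (A σ)) ≤
              C * (1 + Real.log (1 + (predErr Xhat σ : ℝ))) *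
                (1 + Real.log (Fintype.card S)) * I.optCost σ.toFinset := by
  refine ⟨108, by norm_num, ?_⟩
  intro U S _ _ _ I Xhat
  obtain ⟨b, hb, hb'⟩ := OSC.exists_b I
  obtain ⟨N, hN0, hN⟩ := OSC.base I
  haveI : Nonempty (Fin N) := ⟨⟨0, hN0⟩⟩
  have hNR : (0:ℝ) < N := by exact_mod_cast hN0
  refine ⟨(PMF.uniformOfFintype (S → Fin N)).map
    (fun θ σ => OSC.GG I Xhat hb N θ σ.reverse), ?_, ?_⟩
  · intro A hA
    rw [PMF.support_map] at hA
    obtain ⟨θ, _, rfl⟩ := hA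
    refine ⟨fun σ x => ?_, fun σ => ?_⟩
    · simp only [List.reverse_append, List.reverse_cons, List.reverse_nil, List.nil_append,
        List.singleton_append, OSC.GG]
      exact Finset.subset_union_left
    · have := OSC.GG_covers I Xhat hb N θ σ.reverse
      rwa [List.toFinset_reverse] at this
  · intro σ hσ
    rw [OSC.tsum_map (fun (θ : S → Fin N) (σ : List U) => OSC.GG I Xhat hb N θ σ.reverse)
      (fun A => I.setCost (A σ))]
    have h1 := OSC.GG_cost I Xhat hb hN σ.reverse
    have h2 := OSC.bud_ph I Xhat hb hb' σ.reverse (List.nodup_reverse.mpr hσ)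
    have h3 : predErr Xhat σ.reverse = predErr Xhat σ := by
      simp [predErr, List.toFinset_reverse]
    rw [h3, List.toFinset_reverse] at h2
    rw [div_le_iff₀ (by simp; positivity)]
    refine h1.trans ?_
    simp only [Fintype.card_fun, Fintype.card_fin, Nat.cast_pow]
    rw [mul_comm]
    apply mul_le_mul_of_nonneg_right _ (by positivity)
    linarith
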